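/- For a connected chordal graph G, the following are equivalent: (i) G has a dominating clique; (ii) diam(G) ≤ 3; (iii) G ∈ G^cs, i.e., s(G,w) = cs(G,w) for every positive weight function w. -/

import Mathlib

open SimpleGraph
open scoped Classical

variable {V : Type*} [Fintype V]

noncomputable def setWeight (w : V → ℝ) (A : Set V) : ℝ :=
  ∑ v : V, if v ∈ A then w v else 0

def IsComponentOf (G : SimpleGraph V) (S C : Set V) : Prop :=
  ∃ c : (G.induce S).ConnectedComponent,
    C = Subtype.val '' {x : ↥S | (G.induce S).connectedComponentMk x = c}

def Touches (G : SimpleGraph V) (C D : Set V) : Prop :=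
  ∃ a ∈ C, ∃ b ∈ D, G.Adj a b

def IsSafeSet (G : SimpleGraph V) (w : V → ℝ) (S : Set V) : Prop :=
  S.Nonempty ∧ S ≠ Set.univ ∧
    ∀ C D : Set V, IsComponentOf G S C → IsComponentOf G Sᶜ D → Touches G C D →
      setWeight w D ≤ setWeight w C

def IsConnSafeSet (G : SimpleGraph V) (w : V → ℝ) (S : Set V) : Prop :=
  IsSafeSet G w S ∧ (G.induce S).Connected

noncomputable def safeNumber (G : SimpleGraph V) (w : V → ℝ) : ℝ :=
  sInf (setWeight w '' {S | IsSafeSet G w S})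

noncomputable def connSafeNumber (G : SimpleGraph V) (w : V → ℝ) : ℝ :=
  sInf (setWeight w '' {S | IsConnSafeSet G w S})

def InGcs (G : SimpleGraph V) : Prop :=
  ∀ w : V → ℝ, (∀ v, 0 < w v) → safeNumber G w = connSafeNumber G w

/-- A graph is chordal iff it has no induced cycle of length at least four. -/
def Chordal (G : SimpleGraph V) : Prop :=
  ∀ n : ℕ, 4 ≤ n → IsEmpty (cycleGraph n ↪g G)


/-- connectedness via closed subsets -/
def CN (G : SimpleGraph V) (S : Set V) : Prop :=
  S.Nonempty ∧ ∀ A ⊆ S, A.Nonempty → (∀ a ∈ A, ∀ b ∈ S, G.Adj a b → b ∈ A) → A = S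

def CMP (G : SimpleGraph V) (S C : Set V) : Prop :=
  C ⊆ S ∧ CN G C ∧ ∀ a ∈ C, ∀ b ∈ S, G.Adj a b → b ∈ C

theorem CN_iff (G : SimpleGraph V) (S : Set V) : CN G S ↔ (G.induce S).Connected := by
  constructor
  · rintro ⟨⟨x, hx⟩, h⟩
    have key := h (Subtype.val '' {y : S | (G.induce S).Reachable ⟨x, hx⟩ y}) (by
      rintro _ ⟨y, -, rfl⟩; exact y.2) ⟨x, ⟨x, hx⟩, Reachable.refl _, rfl⟩ (by
      rintro _ ⟨y, hy, rfl⟩ b hb hab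
      refine ⟨⟨b, hb⟩, ?_, rfl⟩
      exact Reachable.trans hy (Adj.reachable (by simpa using hab)))
    have : Nonempty S := ⟨⟨x, hx⟩⟩
    rw [connected_iff_exists_forall_reachable]
    refine ⟨⟨x, hx⟩, fun y => ?_⟩
    obtain ⟨z, hz, hzy⟩ := key.symm.subset y.2
    have : z = y := Subtype.ext hzy
    exact this ▸ hz
  · intro h
    obtain ⟨x⟩ := h.nonempty
    refine ⟨⟨x, x.2⟩, fun A hA ⟨a, ha⟩ hcl => Set.Subset.antisymm hA ?_⟩
    intro y hy
    obtain ⟨p⟩ := h.preconnected ⟨a, hA ha⟩ ⟨y, hy⟩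
    have : ∀ (u v : S) (p : (G.induce S).Walk u v), (u : V) ∈ A → (v : V) ∈ A := by
      intro u v p
      induction p with
      | nil => exact id
      | cons hadj _ ih => 
        intro hu
        exact ih (hcl _ hu _ (Subtype.property _) (by simpa using hadj))
    exact this _ _ p ha

theorem CMP_iff (G : SimpleGraph V) (S C : Set V) : IsComponentOf G S C ↔ CMP G S C := by
  constructor
  · rintro ⟨c, rfl⟩
    induction c using ConnectedComponent.ind with
    | h v =>
    refine ⟨by rintro _ ⟨y, -, rfl⟩; exact y.2, ⟨⟨v, v, rfl, rfl⟩, ?_⟩, ?_⟩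
    · intro A hA ⟨a, ha⟩ hcl
      refine Set.Subset.antisymm hA ?_
      obtain ⟨a', ha', rfl⟩ := hA ha
      rintro _ ⟨y, hy, rfl⟩
      have hr : (G.induce S).Reachable a' y := ConnectedComponent.exact (ha'.trans hy.symm)
      obtain ⟨p⟩ := hr
      have : ∀ (u v' : S) (p : (G.induce S).Walk u v'), (u : V) ∈ A → (v' : V) ∈ A := by
        intro u v' p
        induction p with
        | nil => exact id
        | @cons u u2 _ hadj _ ih => 
          intro hu
          refine ih (hcl _ hu _ ⟨u2, ?_, rfl⟩ (by simpa using hadj))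
          obtain ⟨u', hu', h2⟩ := hA hu
          have : u' = u := Subtype.ext h2
          subst this
          exact (ConnectedComponent.sound hadj.reachable).symm.trans hu'
      exact this _ _ p ha
    · rintro _ ⟨y, hy, rfl⟩ b hb hab
      refine ⟨⟨b, hb⟩, ?_, rfl⟩
      have : (G.induce S).Adj y ⟨b, hb⟩ := by simpa using hab
      exact (ConnectedComponent.sound this.reachable).symm.trans hy
  · rintro ⟨hCS, ⟨⟨x, hx⟩, h⟩, hcl⟩
    refine ⟨(G.induce S).connectedComponentMk ⟨x, hCS hx⟩, ?_⟩
    apply Set.Subset.antisymm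
    · have := h (C ∩ Subtype.val '' {y : S | (G.induce S).connectedComponentMk y = (G.induce S).connectedComponentMk ⟨x, hCS hx⟩}) Set.inter_subset_left ⟨x, hx, ⟨x, hCS hx⟩, rfl, rfl⟩ (by
        rintro a ⟨ha, y, hy, rfl⟩ b hb hab
        refine ⟨hb, ⟨b, hCS hb⟩, ?_, rfl⟩
        have : (G.induce S).Adj y ⟨b, hCS hb⟩ := by simpa using hab
        exact (ConnectedComponent.sound this.reachable).symm.trans hy)
      rw [← this]; exact Set.inter_subset_right
    · rintro _ ⟨y, hy, rfl⟩
      have hr : (G.induce S).Reachable ⟨x, hCS hx⟩ y := ConnectedComponent.exact hy.symm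
      obtain ⟨p⟩ := hr
      have : ∀ (u v' : S) (p : (G.induce S).Walk u v'), (u : V) ∈ C → (v' : V) ∈ C := by
        intro u v' p
        induction p with
        | nil => exact id
        | @cons u u2 _ hadj _ ih => 
          intro hu
          exact ih (hcl _ hu _ u2.2 (by simpa using hadj))
      exact this _ _ p hx

theorem exists_CMP (G : SimpleGraph V) (S : Set V) {z : V} (hz : z ∈ S) :
    ∃ C, CMP G S C ∧ z ∈ C := by
  refine ⟨_, (CMP_iff G S _).1 ⟨(G.induce S).connectedComponentMk ⟨z, hz⟩, rfl⟩, ⟨z, hz⟩, rfl, rfl⟩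

theorem CN.subset_CMP {G : SimpleGraph V} {S C Z : Set V} (hZ : CN G Z) (hC : CMP G S C)
    (hZS : Z ⊆ S) {z : V} (h1 : z ∈ Z) (h2 : z ∈ C) : Z ⊆ C := by
  have := hZ.2 (Z ∩ C) Set.inter_subset_left ⟨z, h1, h2⟩
    (fun a ha b hb hab => ⟨hb, hC.2.2 a ha.2 b (hZS hb) hab⟩)
  rw [← this]; exact Set.inter_subset_right

theorem CMP.eq {G : SimpleGraph V} {S C Z : Set V} (hZ : CMP G S Z) (hC : CMP G S C)
    {z : V} (h1 : z ∈ Z) (h2 : z ∈ C) : Z = C :=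
  Set.Subset.antisymm (hZ.2.1.subset_CMP hC hZ.1 h1 h2) (hC.2.1.subset_CMP hZ hC.1 h2 h1)

/-- boundary edge -/
theorem CN.cut {G : SimpleGraph V} {S A : Set V} (hS : CN G S) (hA : A ⊆ S) (hne : A.Nonempty)
    (hneq : ∃ z ∈ S, z ∉ A) : ∃ a ∈ A, ∃ b ∈ S, b ∉ A ∧ G.Adj a b := by
  by_contra! h
  obtain ⟨z, hz, hzA⟩ := hneq
  have := hS.2 A hA hne (fun a ha b hb hab => by
    by_contra hbA
    exact h a ha b hb hbA hab)
  exact hzA (this ▸ hz)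

theorem CN.union {G : SimpleGraph V} {S T : Set V} (hS : CN G S) (hT : CN G T)
    (h : Touches G S T) : CN G (S ∪ T) := by
  obtain ⟨s, hs, t, ht, hst⟩ := h
  refine ⟨⟨s, Or.inl hs⟩, fun A hA ⟨a, ha⟩ hcl => ?_⟩
  have h1 : ∀ z ∈ A, z ∈ S → S ⊆ A := fun z hz hzS => by
    have := hS.2 (S ∩ A) Set.inter_subset_left ⟨z, hzS, hz⟩
      (fun a ha b hb hab => ⟨hb, hcl a ha.2 b (Or.inl hb) hab⟩)
    rw [← this]; exact Set.inter_subset_right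
  have h2 : ∀ z ∈ A, z ∈ T → T ⊆ A := fun z hz hzS => by
    have := hT.2 (T ∩ A) Set.inter_subset_left ⟨z, hzS, hz⟩
      (fun a ha b hb hab => ⟨hb, hcl a ha.2 b (Or.inr hb) hab⟩)
    rw [← this]; exact Set.inter_subset_right
  refine Set.Subset.antisymm hA ?_
  rcases hA ha with h | h
  · have hSA := h1 a ha h
    exact Set.union_subset hSA (h2 t (hcl s (hSA hs) t (Or.inr ht) hst) ht)
  · have hTA := h2 a ha h
    exact Set.union_subset (h1 s (hcl t (hTA ht) s (Or.inl hs) hst.symm) hs) hTA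

theorem CN_singleton (G : SimpleGraph V) (x : V) : CN G {x} := by
  refine ⟨⟨x, rfl⟩, fun A hA ⟨a, ha⟩ _ => ?_⟩
  refine Set.Subset.antisymm hA ?_
  have := hA ha
  rintro y rfl
  rw [Set.mem_singleton_iff] at this
  exact this ▸ ha

theorem CN.insert {G : SimpleGraph V} {S : Set V} (hS : CN G S) {a s : V} (ha : a ∈ S)
    (h : G.Adj a s) : CN G (S ∪ {s}) :=
  hS.union (CN_singleton G s) ⟨a, ha, s, rfl, h⟩

theorem CN_clique {G : SimpleGraph V} {K : Set V} (hK : G.IsClique K) (hne : K.Nonempty) :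
    CN G K := by
  refine ⟨hne, fun A hA ⟨a, ha⟩ hcl => Set.Subset.antisymm hA fun y hy => ?_⟩
  by_cases h : a = y
  · exact h ▸ ha
  · exact hcl a ha y hy (hK (hA ha) hy h)

theorem CN_univ {G : SimpleGraph V} (hG : G.Connected) : CN G Set.univ := by
  obtain ⟨x⟩ := hG.nonempty
  refine ⟨⟨x, trivial⟩, fun A _ ⟨a, ha⟩ hcl => ?_⟩
  refine Set.eq_univ_of_forall fun y => ?_
  obtain ⟨p⟩ := hG.preconnected a y
  induction p with
  | nil => exact ha
  | cons hadj _ ih => exact ih (hcl _ ha _ trivial hadj)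

/-- existence of walks as functions -/
theorem CN.path {G : SimpleGraph V} {S : Set V} (hS : CN G S) {s t : V} (hs : s ∈ S) (ht : t ∈ S) :
    ∃ (a : ℕ) (f : ℕ → V), f 0 = s ∧ f a = t ∧ (∀ i ≤ a, f i ∈ S) ∧
      ∀ i < a, G.Adj (f i) (f (i+1)) := by
  have key := hS.2 {t | t ∈ S ∧ ∃ (a : ℕ) (f : ℕ → V), f 0 = s ∧ f a = t ∧ (∀ i ≤ a, f i ∈ S) ∧
      ∀ i < a, G.Adj (f i) (f (i+1))} (fun t ht => ht.1)
      ⟨s, hs, 0, fun _ => s, rfl, rfl, fun _ _ => hs, by simp⟩ (by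
      rintro x ⟨hx, a, f, h0, ha, hin, hadj⟩ b hb hxb
      refine ⟨hb, a+1, fun i => if i ≤ a then f i else b, by simpa, by simp, ?_, ?_⟩
      · intro i hi
        by_cases h : i ≤ a
        · simpa [h] using hin i h
        · simpa [h] using hb
      · intro i hi
        by_cases h : i + 1 ≤ a
        · simpa [h, (by omega : i ≤ a)] using hadj i h
        · have : i = a := by omega
          subst this
          simpa [ha] using hxb)
  rw [← key] at ht
  exact ht.2

theorem induced_path {G : SimpleGraph V} {X : Set V} (hX : CN G X) {s t : V}
    (hst : s ≠ t) (hn : ¬ G.Adj s t)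
    (hsX : ∃ x ∈ X, G.Adj x s) (htX : ∃ x ∈ X, G.Adj x t) :
    ∃ (a : ℕ) (f : ℕ → V), 2 ≤ a ∧ f 0 = s ∧ f a = t ∧ (∀ i, 0 < i → i < a → f i ∈ X) ∧
      (∀ i j, i < j → j ≤ a → (G.Adj (f i) (f j) ↔ j = i + 1)) ∧
      (∀ i j, i < j → j ≤ a → f i ≠ f j) := by
  obtain ⟨x, hx, hxs⟩ := hsX
  obtain ⟨y, hy, hyt⟩ := htX
  have hS : CN G ((X ∪ {s}) ∪ {t}) := (hX.insert hx hxs).insert (Or.inl hy) hyt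
  have hex : ∃ a : ℕ, ∃ (f : ℕ → V), f 0 = s ∧ f a = t ∧ (∀ i ≤ a, f i ∈ ((X ∪ {s}) ∪ {t})) ∧
      ∀ i < a, G.Adj (f i) (f (i+1)) := hS.path (by simp) (by simp)
  obtain ⟨f, h0, ha, hin, hadj⟩ := Nat.find_spec hex
  have hmin := fun m hm => Nat.find_min (m := m) hex hm
  generalize Nat.find hex = a at *
  have hinj : ∀ i j, i < j → j ≤ a → f i ≠ f j := by
    intro i j hij hja he
    refine hmin (a - (j - i)) (by omega) ⟨fun k => if k ≤ i then f k else f (k + (j - i)), by simpa, ?_, ?_, ?_⟩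
    · by_cases h : a - (j - i) ≤ i
      · have h1 : a = j := by omega
        have h2 : a - (j - i) = i := by omega
        dsimp only
        rw [if_pos h, h2, he, ← h1, ha]
      · simp only [h, if_false]
        rw [← ha]; congr 1; omega
    · intro k hk
      dsimp only
      split_ifs <;> exact hin _ (by omega)
    · intro k hk
      dsimp only
      by_cases h : k + 1 ≤ i
      · rw [if_pos h, if_pos (by omega)]; exact hadj _ (by omega)
      · by_cases h' : k = i
        · subst h'
          rw [if_pos le_rfl, if_neg h, he]
          have := hadj j (by omega)
          convert this using 2; omega
        · rw [if_neg h, if_neg (by omega)]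
          have := hadj (k + (j - i)) (by omega)
          convert this using 2; omega
  have hadj' : ∀ i j, i < j → j ≤ a → (G.Adj (f i) (f j) ↔ j = i + 1) := by
    intro i j hij hja
    constructor
    · intro he
      by_contra hne
      refine hmin (a - (j - i - 1)) (by omega) ⟨fun k => if k ≤ i then f k else f (k + (j - i - 1)), by simpa, ?_, ?_, ?_⟩
      · dsimp only
        rw [if_neg (by omega)]
        rw [← ha]; congr 1; omega
      · intro k hk
        dsimp only
        split_ifs <;> exact hin _ (by omega)
      · intro k hk
        dsimp only
        by_cases h : k + 1 ≤ i
        · rw [if_pos h, if_pos (by omega)]; exact hadj _ (by omega)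
        · by_cases h' : k = i
          · subst h'
            rw [if_pos le_rfl, if_neg h]
            convert he using 2; omega
          · rw [if_neg h, if_neg (by omega)]
            have := hadj (k + (j - i - 1)) (by omega)
            convert this using 2; omega
    · rintro rfl
      exact hadj i (by omega)
  refine ⟨a, f, ?_, h0, ha, ?_, hadj', hinj⟩
  · by_contra h
    interval_cases a
    · exact hst (h0.symm.trans ha)
    · have := hadj 0 (by omega)
      rw [h0, zero_add, ha] at this
      exact hn this
  · intro i h1 h2
    rcases hin i h2.le with (h | h) | h
    · exact h
    · exact absurd (h0.trans h.symm) (hinj 0 i h1 h2.le)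
    · exact absurd (h.trans ha.symm) (hinj i a h2 le_rfl)

theorem cycleGraph_adj_nat {n : ℕ} (hn : 4 ≤ n) (u v : Fin n) (huv : u.val < v.val) :
    (cycleGraph n).Adj u v ↔ v.val = u.val + 1 ∨ (u.val = 0 ∧ v.val + 1 = n) := by
  rw [cycleGraph_adj']
  have h1 : (v - u).val = v.val - u.val := Fin.sub_val_of_le huv.le
  have h2 : (u - v).val = n + u.val - v.val := by
    rw [Fin.val_sub]
    have := v.2
    rw [Nat.mod_eq_of_lt (by omega)]; omega
  have := v.2
  rw [h1, h2]; omega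

/-- Key lemma on chordal graphs. -/
theorem lemS {G : SimpleGraph V} (hch : Chordal G) {X Y : Set V} (hX : CN G X) (hY : CN G Y)
    (hd : Disjoint X Y) (hnt : ¬ Touches G X Y) {s t : V} (hst : s ≠ t)
    (hsX : ∃ x ∈ X, G.Adj x s) (htX : ∃ x ∈ X, G.Adj x t)
    (hsY : ∃ x ∈ Y, G.Adj x s) (htY : ∃ x ∈ Y, G.Adj x t) : G.Adj s t := by
  by_contra hn
  obtain ⟨a, f, ha, f0, fa, fX, fadj, finj⟩ := induced_path hX hst hn hsX htX
  obtain ⟨b, g, hb, g0, gb, gY, gadj, ginj⟩ := induced_path hY hst hn hsY htY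
  have hfg : ∀ i j, 0 < i → i < a → 0 < j → j < b → f i ≠ g j ∧ ¬ G.Adj (f i) (g j) := by
    intro i j h1 h2 h3 h4
    refine ⟨fun h => ?_, fun h => hnt ⟨_, fX i h1 h2, _, gY j h3 h4, h⟩⟩
    exact Set.disjoint_left.1 hd (fX i h1 h2) (h ▸ gY j h3 h4)
  let F : Fin (a + b) → V := fun i => if i.val ≤ a then f i else g (a + b - i)
  have key : ∀ u v : Fin (a+b), u.val < v.val → F u ≠ F v ∧ (G.Adj (F u) (F v) ↔
      (v.val = u.val + 1 ∨ (u.val = 0 ∧ v.val + 1 = a + b))) := by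
    rintro ⟨u, hu⟩ ⟨v, hv⟩ huv
    simp only at huv
    simp only [F]
    by_cases h2 : v ≤ a
    · rw [if_pos (by omega), if_pos h2]
      refine ⟨finj _ _ huv h2, ?_⟩
      rw [fadj _ _ huv h2]; omega
    · rw [if_neg h2]
      by_cases h1 : u ≤ a
      · rw [if_pos h1]
        rcases Nat.eq_zero_or_pos u with h | h
        · subst h
          rw [f0, ← g0]
          refine ⟨ginj _ _ (by omega) (by omega), ?_⟩
          rw [gadj _ _ (by omega) (by omega)]; omega
        · rcases Nat.lt_or_ge u a with h' | h'
          · have := hfg u (a + b - v) h h' (by omega) (by omega)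
            refine ⟨this.1, ?_⟩
            simp only [this.2, false_iff]; omega
          · have : u = a := by omega
            subst this
            rw [fa, ← gb]
            refine ⟨(ginj _ _ (by omega) (by omega)).symm, ?_⟩
            rw [G.adj_comm, gadj _ _ (by omega) (by omega)]; omega
      · rw [if_neg h1]
        refine ⟨(ginj _ _ (by omega) (by omega)).symm, ?_⟩
        rw [G.adj_comm, gadj _ _ (by omega) (by omega)]; omega
  refine (hch (a + b) (by omega)).false ⟨⟨F, ?_⟩, ?_⟩
  · intro u v h
    by_contra hne
    rcases Nat.lt_or_gt_of_ne (fun h => hne (Fin.ext h)) with h' | h'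
    · exact (key u v h').1 h
    · exact (key v u h').1 h.symm
  · intro u v
    change G.Adj (F u) (F v) ↔ _
    rcases Nat.lt_trichotomy u.val v.val with h' | h' | h'
    · rw [(key u v h').2, cycleGraph_adj_nat (by omega) u v h']
    · have : u = v := Fin.ext h'
      subst this
      simp
    · rw [G.adj_comm, (key v u h').2, SimpleGraph.adj_comm, cycleGraph_adj_nat (by omega) v u h']

theorem exists_max_set (P : Set V → Prop) {A : Set V} (hA : P A) :
    ∃ M, A ⊆ M ∧ P M ∧ ∀ N, P N → M ⊆ N → N = M := by
  obtain ⟨M, hAM, hM⟩ := (Set.toFinite {S | P S}).exists_le_maximal hA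
  exact ⟨M, hAM, hM.prop, fun N hN hMN => (hM.eq_of_le hN hMN).symm⟩

theorem Touches.symm {G : SimpleGraph V} {A B : Set V} (h : Touches G A B) : Touches G B A := by
  obtain ⟨a, ha, b, hb, hab⟩ := h
  exact ⟨b, hb, a, ha, hab.symm⟩

/-- absorb part of `D` into `X`. -/
theorem lemT {G : SimpleGraph V} {X Y D : Set V} (hX : CN G X) (hD : CN G D)
    (hnt : ¬ Touches G X Y) (hdX : Touches G D X) (hdY : Touches G D Y) :
    ∃ X' s, X ⊆ X' ∧ X' ⊆ X ∪ D ∧ CN G X' ∧ ¬ Touches G X' Y ∧ s ∈ D ∧ s ∉ X' ∧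
      (∃ x ∈ X', G.Adj x s) ∧ ∃ y ∈ Y, G.Adj y s := by
  obtain ⟨M, hXM, ⟨h1, h2, h3⟩, hmax⟩ := exists_max_set
    (fun M => M ⊆ X ∪ D ∧ CN G M ∧ ¬ Touches G M Y) (A := X) ⟨Set.subset_union_left, hX, hnt⟩
  have hU : CN G (X ∪ D) := hX.union hD hdX.symm
  obtain ⟨d, hd, y, hy, hdy⟩ := hdY
  obtain ⟨a, ha, s, hs, hsM, has⟩ := hU.cut h1 h2.1 ⟨d, Or.inr hd, fun h => h3 ⟨d, h, y, hy, hdy⟩⟩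
  refine ⟨M, s, hXM, h1, h2, h3, ?_, hsM, ⟨a, ha, has⟩, ?_⟩
  · rcases hs with hs | hs
    · exact absurd (hXM hs) hsM
    · exact hs
  · by_contra hcon
    push Not at hcon
    have := hmax (M ∪ {s}) ⟨Set.union_subset h1 (by simpa using hs), h2.insert ha has, ?_⟩
      Set.subset_union_left
    · exact hsM (this ▸ Or.inr rfl)
    · rintro ⟨p, hp | hp, q, hq, hpq⟩
      · exact h3 ⟨p, hp, q, hq, hpq⟩
      · rw [Set.mem_singleton_iff] at hp
        subst hp
        exact hcon q hq hpq.symm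

theorem lemS' {G : SimpleGraph V} (hch : Chordal G) {X Y D E : Set V} (hX : CN G X) (hY : CN G Y)
    (hD : CN G D) (hE : CN G E) (hXY : ¬ Touches G X Y) (hDE : ¬ Touches G D E)
    (dXY : Disjoint X Y) (dDE : Disjoint D E) (dYD : Disjoint Y D) (dYE : Disjoint Y E)
    (h1 : Touches G D X) (h2 : Touches G D Y) (h3 : Touches G E X) (h4 : Touches G E Y) : False := by
  obtain ⟨X1, s, a1, a2, a3, a4, a5, a6, a7, a8⟩ := lemT hX hD hXY h1 h2
  have h3' : Touches G E X1 := by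
    obtain ⟨e, he, x, hx, hex⟩ := h3
    exact ⟨e, he, x, a1 hx, hex⟩
  obtain ⟨X2, t, b1, b2, b3, b4, b5, b6, b7, b8⟩ := lemT a3 hE a4 h3' h4
  obtain ⟨x, hx, hxs⟩ := a7
  have hne : s ≠ t := fun h => Set.disjoint_left.1 dDE a5 (h ▸ b5)
  refine hDE ⟨s, a5, t, b5, ?_⟩
  refine lemS hch b3 hY ?_ b4 hne ⟨x, b1 hx, hxs⟩ b7 a8 b8
  rw [Set.disjoint_left] at *
  intro z hz hzY
  rcases b2 hz with h | h
  · rcases a2 h with h | h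
    · exact dXY h hzY
    · exact dYD hzY h
  · exact dYE hzY h

/-- A full component of a clique contains a vertex complete to the clique. -/
theorem lemF {G : SimpleGraph V} (hch : Chordal G) {Q K : Set V} (hQ : CN G Q) (hK : G.IsClique K)
    (hKQ : ∀ k ∈ K, k ∉ Q ∧ ∃ q ∈ Q, G.Adj q k) : ∃ q ∈ Q, ∀ k ∈ K, G.Adj q k := by
  obtain ⟨q0, hq0⟩ := hQ.1
  obtain ⟨M, -, ⟨q, hq, hqM⟩, hmax⟩ := exists_max_set
    (fun M => ∃ q ∈ Q, M = {k | k ∈ K ∧ G.Adj q k}) ⟨q0, hq0, rfl⟩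
  refine ⟨q, hq, ?_⟩
  by_contra! hcon
  obtain ⟨s, hs, hqs⟩ := hcon
  obtain ⟨X, hqX, ⟨h1, h2, h3⟩, hXmax⟩ := exists_max_set
    (fun X => X ⊆ Q ∧ CN G X ∧ ∀ x ∈ X, ¬ G.Adj x s) (A := {q})
    ⟨by simpa using hq, CN_singleton G q, by simpa using hqs⟩
  have hqX : q ∈ X := hqX rfl
  obtain ⟨hsQ, z, hz, hzs⟩ := hKQ s hs
  obtain ⟨a, ha, r, hr, hrX, har⟩ := hQ.cut h1 h2.1 ⟨z, hz, fun h => h3 z h hzs⟩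
  have hrs : G.Adj r s := by
    by_contra hn
    have := hXmax (X ∪ {r}) ⟨Set.union_subset h1 (by simpa using hr), h2.insert ha har, ?_⟩
      Set.subset_union_left
    · exact hrX (this ▸ Or.inr rfl)
    · rintro x (hx | hx)
      · exact h3 x hx
      · rw [Set.mem_singleton_iff] at hx
        exact hx ▸ hn
  have := hmax _ ⟨r, hr, rfl⟩ (by
    rw [hqM]
    rintro t ⟨htK, hqt⟩
    refine ⟨htK, ?_⟩
    have hst : s ≠ t := by rintro rfl; exact hqs hqt
    refine (lemS hch h2 (CN_singleton G s) ?_ ?_ ?_ ⟨q, hqX, hqt⟩ ⟨a, ha, har⟩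
      ⟨s, rfl, hK hs htK hst⟩ ⟨s, rfl, hrs.symm⟩).symm
    · rw [Set.disjoint_singleton_right]
      exact fun h => hsQ (h1 h)
    · rintro ⟨x, hx, y, hy, hxy⟩
      rw [Set.mem_singleton_iff] at hy
      exact h3 x hx (hy ▸ hxy)
    · rintro rfl; exact (hKQ t htK).1 hr)
  have hsm : s ∈ M := by
    rw [← this]; exact ⟨hs, hrs⟩
  rw [hqM] at hsm
  exact hqs hsm.2

theorem dist_le_three {G : SimpleGraph V} (hG : G.Connected) {u v : V} (h : G.dist u v ≤ 3) :
    ∃ p q, (u = p ∨ G.Adj u p) ∧ (p = q ∨ G.Adj p q) ∧ (q = v ∨ G.Adj q v) := by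
  obtain ⟨p, hp⟩ := hG.exists_walk_length_eq_dist u v
  rw [← hp] at h
  clear hp
  match p, h with
  | .nil, _ => exact ⟨u, u, by simp⟩
  | .cons h1 .nil, _ => exact ⟨v, v, by simp [h1]⟩
  | .cons h1 (.cons h2 .nil), _ => exact ⟨_, v, Or.inr h1, Or.inr h2, Or.inl rfl⟩
  | .cons h1 (.cons h2 (.cons h3 .nil)), _ => exact ⟨_, _, Or.inr h1, Or.inr h2, Or.inr h3⟩
  | .cons h1 (.cons h2 (.cons h3 (.cons h4 p))), h => 
    simp only [Walk.length_cons] at h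
    omega

theorem dist_adj_le {G : SimpleGraph V} (hG : G.Connected) (x : V) {u v : V}
    (h : u = v ∨ G.Adj u v) : G.dist x v ≤ G.dist x u + 1 := by
  rcases h with rfl | h
  · omega
  · have := hG.dist_triangle (u := x) (v := u) (w := v)
    rw [dist_eq_one_iff_adj.2 h] at this
    exact this

theorem clique_dist {G : SimpleGraph V} (hG : G.Connected) {K : Set V} (hK : G.IsClique K)
    (hd : ∀ v ∉ K, ∃ u ∈ K, G.Adj v u) (u v : V) : G.dist u v ≤ 3 := by
  have h : ∀ v, ∃ k ∈ K, v = k ∨ G.Adj v k := fun v => by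
    by_cases hv : v ∈ K
    · exact ⟨v, hv, Or.inl rfl⟩
    · obtain ⟨k, hk, hvk⟩ := hd v hv
      exact ⟨k, hk, Or.inr hvk⟩
  obtain ⟨k, hk, h1⟩ := h u
  obtain ⟨l, hl, h2⟩ := h v
  have h3 : k = l ∨ G.Adj k l := by
    by_cases hkl : k = l
    · exact Or.inl hkl
    · exact Or.inr (hK hk hl hkl)
  have a1 := dist_adj_le hG u h1
  have a2 := dist_adj_le hG u h3
  have a3 := dist_adj_le hG u (u := l) (v := v) (h2.imp Eq.symm fun h => h.symm)
  have : G.dist u u = 0 := dist_self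
  omega

theorem dist_clique {G : SimpleGraph V} (hG : G.Connected) (hch : Chordal G)
    (hd : ∀ u v, G.dist u v ≤ 3) :
    ∃ K : Set V, G.IsClique K ∧ ∀ v ∉ K, ∃ u ∈ K, G.Adj v u := by
  by_contra! hcon
  have key : ∀ (n : ℕ) (K Q : Set V), G.IsClique K → CN G Q → (∀ q ∈ Q, q ∉ K) →
      (∀ q ∈ Q, ∀ b, G.Adj q b → b ∈ Q ∨ b ∈ K) → ∀ v ∈ Q, (∀ k ∈ K, ¬ G.Adj v k) →
      Q.ncard ≤ n → False := by
    intro n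
    induction n with
    | zero =>
      intro K Q hK hQ hQK hcl v hv hvK hn
      have : Q = ∅ := (Set.ncard_eq_zero (Set.toFinite _)).1 (by omega)
      simp [this] at hv
    | succ n ih =>
      intro K Q hK hQ hQK hcl v hv hvK hn
      let K' : Set V := {k | k ∈ K ∧ ∃ q ∈ Q, G.Adj q k}
      have hK' : G.IsClique K' := hK.subset (fun k hk => hk.1)
      have hcl' : ∀ q ∈ Q, ∀ b, G.Adj q b → b ∈ Q ∨ b ∈ K' := fun q hq b hqb =>
        (hcl q hq b hqb).imp id fun h => ⟨h, q, hq, hqb⟩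
      have hdom : ∀ w, w ∈ Q ∨ w ∈ K' ∨ ∃ k ∈ K', G.Adj k w := by
        intro w
        obtain ⟨p, q, h1, h2, h3⟩ := dist_le_three hG (hd v w)
        have hp : p ∈ Q := by
          rcases h1 with rfl | h1
          · exact hv
          · exact (hcl v hv p h1).resolve_right fun h => hvK p h h1
        have hq : q ∈ Q ∨ q ∈ K' := by
          rcases h2 with rfl | h2
          · exact Or.inl hp
          · exact hcl' p hp q h2
        rcases h3 with rfl | h3
        · tauto
        · rcases hq with hq | hq
          · have := hcl' q hq w h3; tauto
          · exact Or.inr (Or.inr ⟨q, hq, h3⟩)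
      obtain ⟨q, hq, hqK⟩ := lemF hch hQ hK' (fun k hk => ⟨fun h => hQK k h hk.1, hk.2⟩)
      have hK2 : G.IsClique (insert q K') := hK'.insert (fun b hb _ => hqK b hb)
      obtain ⟨v', hv', hnv'⟩ := hcon _ hK2
      have hv'Q : v' ∈ Q := by
        rcases hdom v' with h | h | ⟨k, hk, h⟩
        · exact h
        · exact absurd (Set.mem_insert_of_mem _ h) hv'
        · exact absurd h.symm (hnv' k (Set.mem_insert_of_mem _ hk))
      obtain ⟨Q', hQ', hvQ'⟩ := exists_CMP G (insert q K')ᶜ hv'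
      have hcmp : CMP G K'ᶜ Q := ⟨fun x hx hxK => hQK x hx hxK.1, hQ, fun a ha b hb hab =>
        (hcl' a ha b hab).resolve_right hb⟩
      have hsub : Q' ⊆ Q := hQ'.2.1.subset_CMP hcmp
        (fun x hx h => hQ'.1 hx (Set.mem_insert_of_mem _ h)) hvQ' hv'Q
      refine ih (insert q K') Q' hK2 hQ'.2.1 (fun x hx => hQ'.1 hx) ?_ v' hvQ' hnv' ?_
      · intro x hx b hxb
        by_cases hb : b ∈ insert q K'
        · exact Or.inr hb
        · exact Or.inl (hQ'.2.2 x hx b hb hxb)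
      · have : Q'.ncard < Q.ncard := Set.ncard_lt_ncard
          ⟨hsub, fun h => hQ'.1 (h hq) (Set.mem_insert _ _)⟩ (Set.toFinite _)
        omega
  obtain ⟨v⟩ := hG.nonempty
  exact key _ ∅ Set.univ (by simp) (CN_univ hG) (by simp) (by simp) v trivial (by simp) le_rfl

theorem sw_mono {w : V → ℝ} (hw : ∀ v, 0 < w v) {A B : Set V} (h : A ⊆ B) :
    setWeight w A ≤ setWeight w B := by
  unfold setWeight
  refine Finset.sum_le_sum fun v _ => ?_
  by_cases h1 : v ∈ A
  · simp [h1, h h1]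
  · simp only [h1, if_false]
    split_ifs
    · exact (hw v).le
    · exact le_rfl

theorem sw_union {w : V → ℝ} {A B : Set V} (h : Disjoint A B) :
    setWeight w (A ∪ B) = setWeight w A + setWeight w B := by
  unfold setWeight
  rw [← Finset.sum_add_distrib]
  refine Finset.sum_congr rfl fun v _ => ?_
  by_cases h1 : v ∈ A
  · have : v ∉ B := Set.disjoint_left.1 h h1
    simp [h1, this]
  · simp [h1]

theorem sw_pos {w : V → ℝ} (hw : ∀ v, 0 < w v) {A : Set V} (h : A.Nonempty) :
    0 < setWeight w A := by
  obtain ⟨a, ha⟩ := h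
  unfold setWeight
  refine Finset.sum_pos' (fun v _ => ?_) ⟨a, Finset.mem_univ _, by simpa [ha] using hw a⟩
  split_ifs
  · exact (hw v).le
  · exact le_rfl

theorem CMP.disjoint {G : SimpleGraph V} {S C Z : Set V} (hZ : CMP G S Z) (hC : CMP G S C)
    (h : Z ≠ C) : Disjoint Z C :=
  Set.disjoint_left.2 fun _ h1 h2 => h (hZ.eq hC h1 h2)

theorem CMP.not_touch {G : SimpleGraph V} {S C Z : Set V} (hZ : CMP G S Z) (hC : CMP G S C)
    (h : Z ≠ C) : ¬ Touches G Z C := by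
  rintro ⟨a, ha, b, hb, hab⟩
  exact h (hZ.eq hC (hZ.2.2 a ha b (hC.1 hb) hab) hb)

/-- A safe-set criterion for connected sets. -/
theorem connSafe_of {G : SimpleGraph V} {w : V → ℝ} {T : Set V} (hT : CN G T)
    (hne : T ≠ Set.univ) (h : ∀ Z, CMP G Tᶜ Z → setWeight w Z ≤ setWeight w T) :
    IsConnSafeSet G w T := by
  refine ⟨⟨hT.1, hne, fun C D hC hD _ => ?_⟩, (CN_iff G T).1 hT⟩
  rw [CMP_iff] at hC hD
  have : CMP G T T := ⟨subset_rfl, hT, fun _ _ _ h _ => h⟩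
  obtain ⟨c, hc⟩ := hC.2.1.1
  rw [hC.eq this hc (hC.1 hc)]
  exact h D hD

theorem star_core {G : SimpleGraph V} (hch : Chordal G) {w : V → ℝ}
    (hw : ∀ v, 0 < w v) {S C₁ D₁ : Set V} (hS : IsSafeSet G w S)
    (hC₁ : CMP G S C₁) (hD₁ : CMP G Sᶜ D₁)
    (hC : ∀ C, CMP G S C → Touches G C D₁) (hD : ∀ D, CMP G Sᶜ D → Touches G C₁ D) :
    ∃ T, IsConnSafeSet G w T ∧ setWeight w T ≤ setWeight w S := by
  have hsafe : ∀ C D, CMP G S C → CMP G Sᶜ D → Touches G C D → setWeight w D ≤ setWeight w C :=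
    fun C D h1 h2 h3 => hS.2.2 C D ((CMP_iff _ _ _).2 h1) ((CMP_iff _ _ _).2 h2) h3
  by_cases hSC : S = C₁
  · exact ⟨S, ⟨hS, (CN_iff _ _).1 (hSC ▸ hC₁.2.1)⟩, le_rfl⟩
  obtain ⟨z₂, hz₂, hz₂C⟩ : ∃ z ∈ S, z ∉ C₁ := by
    by_contra! h
    exact hSC (Set.Subset.antisymm h hC₁.1)
  have dCD : ∀ C D, CMP G S C → CMP G Sᶜ D → Disjoint C D := fun C D h1 h2 =>
    Set.disjoint_left.2 fun x hx hx' => h2.1 hx' (h1.1 hx)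
  -- double star
  have hstar : ∀ C D, CMP G S C → CMP G Sᶜ D → C ≠ C₁ → D ≠ D₁ → ¬ Touches G C D := by
    intro C D h1 h2 h3 h4 h5
    exact lemS' hch hC₁.2.1 h1.2.1 hD₁.2.1 h2.2.1 (hC₁.not_touch h1 h3.symm)
      (hD₁.not_touch h2 h4.symm) (hC₁.disjoint h1 h3.symm) (hD₁.disjoint h2 h4.symm)
      (dCD _ _ h1 hD₁) (dCD _ _ h1 h2) (hD _ hD₁).symm (hC _ h1).symm (hD _ h2).symm h5.symm
  -- heaviest other component
  obtain ⟨C₂, hC₂, hzC₂⟩ := exists_CMP G S hz₂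
  have hC₂ne : C₂ ≠ C₁ := fun h => hz₂C (h ▸ hzC₂)
  obtain ⟨M, ⟨hM, hMne⟩, hMmax⟩ := Set.exists_max_image {C | CMP G S C ∧ C ≠ C₁} (setWeight w)
    (Set.toFinite _) ⟨C₂, hC₂, hC₂ne⟩
  let piece : Set V → Prop := fun P => CMP G S P ∨ CMP G Sᶜ P
  have hpiece : ∀ z, ∃ P, piece P ∧ z ∈ P := by
    intro z
    by_cases h : z ∈ S
    · obtain ⟨P, h1, h2⟩ := exists_CMP G S h
      exact ⟨P, Or.inl h1, h2⟩
    · obtain ⟨P, h1, h2⟩ := exists_CMP G Sᶜ h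
      exact ⟨P, Or.inr h1, h2⟩
  have hpeq : ∀ P Q, piece P → piece Q → ∀ z, z ∈ P → z ∈ Q → P = Q := by
    rintro P Q (hP | hP) (hQ | hQ) z h1 h2
    · exact hP.eq hQ h1 h2
    · exact absurd (hP.1 h1) (hQ.1 h2)
    · exact absurd (hQ.1 h2) (hP.1 h1)
    · exact hP.eq hQ h1 h2
  have hMD₁ : setWeight w D₁ ≤ setWeight w M := hsafe _ _ hM hD₁ (hC _ hM)
  have hpair : ∀ P Q, CMP G S P → CMP G S Q → P ≠ Q →
      setWeight w P + setWeight w Q ≤ setWeight w S := by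
    intro P Q hP hQ hne
    rw [← sw_union (hP.disjoint hQ hne)]
    exact sw_mono hw (Set.union_subset hP.1 hQ.1)
  obtain ⟨T, h0T, ⟨hTp, hTM, hTw⟩, hTmax⟩ := exists_max_set (fun T =>
      (∀ P, piece P → ∀ z ∈ P, z ∈ T → P ⊆ T) ∧ Disjoint T M ∧ setWeight w T ≤ setWeight w S)
      (A := C₁ ∪ D₁) ⟨by
        rintro P hP z hz (h | h)
        · rw [hpeq P C₁ hP (Or.inl hC₁) z hz h]; exact Set.subset_union_left
        · rw [hpeq P D₁ hP (Or.inr hD₁) z hz h]; exact Set.subset_union_right,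
      Disjoint.union_left (hC₁.disjoint hM hMne.symm) (dCD _ _ hM hD₁).symm, by
        rw [sw_union (dCD _ _ hC₁ hD₁)]
        have := hpair _ _ hC₁ hM hMne.symm
        linarith⟩
  have hC₁T : C₁ ⊆ T := Set.subset_union_left.trans h0T
  have hD₁T : D₁ ⊆ T := Set.subset_union_right.trans h0T
  have hTcn : CN G T := by
    have h12 : CN G (C₁ ∪ D₁) := hC₁.2.1.union hD₁.2.1 (hC _ hC₁)
    refine ⟨h12.1.mono h0T, fun A hA ⟨a, ha⟩ hcl => Set.Subset.antisymm hA ?_⟩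
    have hfull : ∀ P, CN G P → P ⊆ T → ∀ z ∈ P, z ∈ A → P ⊆ A := by
      intro P hP hPT z hz hzA
      have := hP.2 (P ∩ A) Set.inter_subset_left ⟨z, hz, hzA⟩
        (fun a ha b hb hab => ⟨hb, hcl a ha.2 b (hPT hb) hab⟩)
      rw [← this]; exact Set.inter_subset_right
    have htouch : ∀ P, piece P → CN G (P ∪ (C₁ ∪ D₁)) := by
      rintro P (hP | hP)
      · obtain ⟨x, hx, y, hy, hxy⟩ := hC P hP
        exact hP.2.1.union h12 ⟨x, hx, y, Or.inr hy, hxy⟩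
      · obtain ⟨x, hx, y, hy, hxy⟩ := hD P hP
        exact hP.2.1.union h12 ⟨y, hy, x, Or.inl hx, hxy.symm⟩
    obtain ⟨P, hP, haP⟩ := hpiece a
    have h0A : C₁ ∪ D₁ ⊆ A := Set.subset_union_right.trans
      (hfull _ (htouch P hP) (Set.union_subset (hTp P hP a haP (hA ha)) h0T) a (Or.inl haP) ha)
    intro y hy
    obtain ⟨P', hP', hyP'⟩ := hpiece y
    obtain ⟨c, hc⟩ := h12.1
    exact hfull _ (htouch P' hP') (Set.union_subset (hTp P' hP' y hyP' hy) h0T) c (Or.inr hc)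
      (h0A hc) (Or.inl hyP')
  have hTne : T ≠ Set.univ := by
    rintro rfl
    obtain ⟨m, hm⟩ := hM.2.1.1
    exact Set.disjoint_left.1 hTM trivial hm
  have hMS : setWeight w M ≤ setWeight w S := sw_mono hw hM.1
  by_cases hall : ∀ z, z ∈ T ∨ z ∈ M
  · have hcompl : Tᶜ = M := by
      ext z
      exact ⟨fun h => (hall z).resolve_left h, fun h h' => Set.disjoint_left.1 hTM h' h⟩
    have hMc : Mᶜ = T := by rw [← hcompl, compl_compl]
    rcases le_total (setWeight w M) (setWeight w T) with h | h
    · refine ⟨T, connSafe_of hTcn hTne fun Z hZ => ?_, hTw⟩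
      exact (sw_mono hw (hcompl ▸ hZ.1)).trans h
    · refine ⟨M, connSafe_of hM.2.1 ?_ fun Z hZ => ?_, hMS⟩
      · rintro rfl
        obtain ⟨m, hm⟩ := hTcn.1
        exact Set.disjoint_left.1 hTM hm trivial
      · exact (sw_mono hw (hMc ▸ hZ.1)).trans h
  · push Not at hall
    obtain ⟨z, hzT, hzM⟩ := hall
    obtain ⟨P, hP, hzP⟩ := hpiece z
    have hPT : Disjoint T P := Set.disjoint_left.2 fun x hx hxP => hzT (hTp P hP x hxP hx hzP)
    have hPM : P ≠ M := by rintro rfl; exact hzM hzP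
    have hlt : setWeight w S < setWeight w T + setWeight w P := by
      by_contra! hle
      have := hTmax (T ∪ P) ⟨?_, ?_, ?_⟩ Set.subset_union_left
      · exact hzT (this ▸ Or.inr hzP)
      · rintro Q hQ x hxQ (hx | hx)
        · exact (hTp Q hQ x hxQ hx).trans Set.subset_union_left
        · rw [hpeq Q P hQ hP x hxQ hx]; exact Set.subset_union_right
      · refine Disjoint.union_left hTM (Set.disjoint_left.2 fun x hx hxM => ?_)
        exact hPM (hpeq P M hP (Or.inl hM) x hx hxM)
      · rw [sw_union hPT]; exact hle
    have hPw : setWeight w P + setWeight w M ≤ setWeight w S := by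
      rcases hP with hP | hP
      · exact hpair _ _ hP hM hPM
      · have h1 := hsafe _ _ hC₁ hP (hD P hP)
        have h2 := hpair _ _ hC₁ hM hMne.symm
        linarith
    refine ⟨T, connSafe_of hTcn hTne fun Z hZ => ?_, hTw⟩
    obtain ⟨x, hx⟩ := hZ.2.1.1
    obtain ⟨Q, hQ, hxQ⟩ := hpiece x
    have hQT : Q ⊆ Tᶜ := fun y hy hyT => hZ.1 hx (hTp Q hQ y hy hyT hxQ)
    have hQcmp : CMP G Tᶜ Q := by
      have hQ' := hQ
      rcases hQ with hQ | hQ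
      · refine ⟨hQT, hQ.2.1, fun a ha b hb hab => ?_⟩
        by_cases hbS : b ∈ S
        · exact hQ.2.2 a ha b hbS hab
        · obtain ⟨D, hD', hbD⟩ := exists_CMP G Sᶜ hbS
          refine absurd ⟨a, ha, b, hbD, hab⟩ (hstar Q D hQ hD' ?_ ?_)
          · rintro rfl; exact hQT hxQ (hC₁T hxQ)
          · rintro rfl; exact hb (hD₁T hbD)
      · refine ⟨hQT, hQ.2.1, fun a ha b hb hab => ?_⟩
        by_cases hbS : b ∈ S
        · obtain ⟨C, hC', hbC⟩ := exists_CMP G S hbS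
          refine absurd ⟨b, hbC, a, ha, hab.symm⟩ (hstar C Q hC' hQ ?_ ?_)
          · rintro rfl; exact hb (hC₁T hbC)
          · rintro rfl; exact hQT hxQ (hD₁T hxQ)
        · exact hQ.2.2 a ha b hbS hab
    rw [hZ.eq hQcmp hx hxQ]
    rcases hQ with hQ | hQ
    · have := hMmax Q ⟨hQ, by rintro rfl; exact hQT hxQ (hC₁T hxQ)⟩
      linarith
    · have h1 := hsafe _ _ hC₁ hQ (hD Q hQ)
      have h2 := sw_mono hw hC₁T
      linarith

theorem clique_conn {G : SimpleGraph V} (hG : G.Connected) (hch : Chordal G) {K : Set V}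
    (hK : G.IsClique K) (hd : ∀ v ∉ K, ∃ u ∈ K, G.Adj v u) {w : V → ℝ}
    (hw : ∀ v, 0 < w v) {S : Set V} (hS : IsSafeSet G w S) :
    ∃ T, IsConnSafeSet G w T ∧ setWeight w T ≤ setWeight w S := by
  have hKne : K.Nonempty := by
    obtain ⟨x⟩ := hG.nonempty
    by_cases hx : x ∈ K
    · exact ⟨x, hx⟩
    · obtain ⟨u, hu, _⟩ := hd x hx
      exact ⟨u, hu⟩
  -- `K` inside a component means everything is in it
  have hin : ∀ U C : Set V, CMP G U C → ∀ k ∈ K, k ∈ C → ∀ l ∈ K, l ∈ U → l ∈ C := by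
    intro U C hC k hk hkC l hl hlU
    by_cases h : k = l
    · exact h ▸ hkC
    · exact hC.2.2 k hkC l hlU (hK hk hl h)
  have hone : ∀ U C : Set V, CMP G U C → K ⊆ U → ∀ k ∈ K, k ∈ C → U = C := by
    intro U C hC hKU k hk hkC
    have hKC : K ⊆ C := fun l hl => hin U C hC k hk hkC l hl (hKU hl)
    refine Set.Subset.antisymm (fun v hv => ?_) hC.1
    by_cases hvK : v ∈ K
    · exact hKC hvK
    · obtain ⟨u, hu, hvu⟩ := hd v hvK
      exact hC.2.2 u (hKC hu) v hv hvu.symm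
  by_cases hKS : K ⊆ S
  · obtain ⟨k, hk⟩ := hKne
    obtain ⟨C, hC, hkC⟩ := exists_CMP G S (hKS hk)
    have := hone S C hC hKS k hk hkC
    exact ⟨S, ⟨hS, (CN_iff _ _).1 (this ▸ hC.2.1)⟩, le_rfl⟩
  · obtain ⟨d, hdK, hdS⟩ := Set.not_subset.1 hKS
    obtain ⟨D₁, hD₁, hdD₁⟩ := exists_CMP G Sᶜ hdS
    by_cases hKS' : K ⊆ Sᶜ
    · have hSD := hone Sᶜ D₁ hD₁ hKS' d hdK hdD₁
      have hC : ∀ C, CMP G S C → Touches G C D₁ := by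
        intro C hC
        obtain ⟨c, hc⟩ := hC.2.1.1
        obtain ⟨u, hu, hcu⟩ := hd c (fun h => hKS' h (hC.1 hc))
        exact ⟨c, hc, u, hSD ▸ hKS' hu, hcu⟩
      obtain ⟨s, hs⟩ := hS.1
      obtain ⟨C₁, hC₁, -⟩ := exists_CMP G S hs
      refine star_core hch hw hS hC₁ hD₁ hC fun D hD => ?_
      obtain ⟨x, hx⟩ := hD.2.1.1
      rw [hD.eq hD₁ hx (hSD ▸ hD.1 hx)]
      exact hC _ hC₁
    · obtain ⟨c, hcK, hcS⟩ := Set.not_subset.1 hKS'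
      rw [Set.notMem_compl_iff] at hcS
      obtain ⟨C₁, hC₁, hcC₁⟩ := exists_CMP G S hcS
      have h0 : Touches G C₁ D₁ := ⟨c, hcC₁, d, hdD₁, hK hcK hdK (by rintro rfl; exact hdS hcS)⟩
      refine star_core hch hw hS hC₁ hD₁ ?_ ?_
      · intro C hC
        by_cases hCC : C = C₁
        · exact hCC ▸ h0
        obtain ⟨x, hx⟩ := hC.2.1.1
        have hxC₁ : x ∉ C₁ := fun h => hCC (hC.eq hC₁ hx h)
        obtain ⟨u, hu, hxu⟩ := hd x (fun h => hxC₁ (hin S C₁ hC₁ c hcK hcC₁ x h (hC.1 hx)))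
        by_cases huS : u ∈ S
        · have := hin S C₁ hC₁ c hcK hcC₁ u hu huS
          exact absurd (hC₁.2.2 u this x (hC.1 hx) hxu.symm) hxC₁
        · exact ⟨x, hx, u, hin Sᶜ D₁ hD₁ d hdK hdD₁ u hu huS, hxu⟩
      · intro D hD
        by_cases hDD : D = D₁
        · exact hDD ▸ h0
        obtain ⟨x, hx⟩ := hD.2.1.1
        have hxD₁ : x ∉ D₁ := fun h => hDD (hD.eq hD₁ hx h)
        obtain ⟨u, hu, hxu⟩ := hd x (fun h => hxD₁ (hin Sᶜ D₁ hD₁ d hdK hdD₁ x h (hD.1 hx)))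
        by_cases huS : u ∈ S
        · exact ⟨u, hin S C₁ hC₁ c hcK hcC₁ u hu huS, x, hx, hxu.symm⟩
        · have := hin Sᶜ D₁ hD₁ d hdK hdD₁ u hu huS
          exact absurd (hD₁.2.2 u this x (hD.1 hx) hxu.symm) hxD₁

theorem clique_Gcs {G : SimpleGraph V} (hG : G.Connected) (hch : Chordal G) {K : Set V}
    (hK : G.IsClique K) (hd : ∀ v ∉ K, ∃ u ∈ K, G.Adj v u) : InGcs G := by
  intro w hw
  unfold safeNumber connSafeNumber
  have hbdd : ∀ A : Set (Set V), BddBelow (setWeight w '' A) := fun A =>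
    (Set.toFinite _).bddBelow
  by_cases hne : ∃ S, IsSafeSet G w S
  · obtain ⟨S, hS⟩ := hne
    obtain ⟨T, hT, -⟩ := clique_conn hG hch hK hd hw hS
    apply le_antisymm
    · refine csInf_le_csInf (hbdd _) ⟨_, T, hT, rfl⟩ (Set.image_mono fun S hS => hS.1)
    · refine le_csInf ⟨_, S, hS, rfl⟩ ?_
      rintro _ ⟨S', hS', rfl⟩
      obtain ⟨T', hT', hle⟩ := clique_conn hG hch hK hd hw hS'
      exact (csInf_le (hbdd _) ⟨T', hT', rfl⟩).trans hle
  · have h1 : {S | IsSafeSet G w S} = ∅ := by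
      ext S; simp only [Set.mem_setOf_eq, Set.mem_empty_iff_false, iff_false]
      exact fun h => hne ⟨S, h⟩
    have h2 : {S | IsConnSafeSet G w S} = ∅ := by
      ext S; simp only [Set.mem_setOf_eq, Set.mem_empty_iff_false, iff_false]
      exact fun h => hne ⟨S, h.1⟩
    rw [h1, h2]

/-- Vertices of a component attached to a clique separator form a connected set. -/
theorem attach_CN {G : SimpleGraph V} (hch : Chordal G) {C₀ L : Set V} (hC : G.IsClique C₀)
    (hL : CMP G C₀ᶜ L) (hne : ∃ v ∈ L, ∃ c ∈ C₀, G.Adj c v) :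
    CN G {v | v ∈ L ∧ ∃ c ∈ C₀, G.Adj c v} := by
  obtain ⟨v₀, hv₀, hc₀⟩ := hne
  refine ⟨⟨v₀, hv₀, hc₀⟩, fun A hA hAne hcl => ?_⟩
  by_contra hAB
  obtain ⟨z, hz, hzA⟩ : ∃ z ∈ {v | v ∈ L ∧ ∃ c ∈ C₀, G.Adj c v}, z ∉ A := by
    by_contra! h
    exact hAB (Set.Subset.antisymm hA h)
  let U : Set V := {v | v ∈ A ∨ ∃ X, CMP G {v | v ∈ L ∧ ¬ ∃ c ∈ C₀, G.Adj c v} X ∧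
    Touches G X A ∧ v ∈ X}
  have hAL : A ⊆ L := fun a ha => (hA ha).1
  obtain ⟨u, hu, v, hvL, hvU, huv⟩ := hL.2.1.cut (A := U) (by
      rintro v (hv | ⟨X, hX, -, hv⟩)
      · exact hAL hv
      · exact (hX.1 hv).1) (hAne.mono fun a ha => Or.inl ha) ⟨z, hz.1, by
      rintro (hv | ⟨X, hX, -, hv⟩)
      · exact hzA hv
      · exact (hX.1 hv).2 hz.2⟩
  have hvA : v ∉ A := fun h => hvU (Or.inl h)
  rcases hu with hu | ⟨X, hX, hXA, huX⟩
  · by_cases hvB : ∃ c ∈ C₀, G.Adj c v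
    · exact hvA (hcl u hu v ⟨hvL, hvB⟩ huv)
    · obtain ⟨X, hX, hvX⟩ := exists_CMP G {v | v ∈ L ∧ ¬ ∃ c ∈ C₀, G.Adj c v} (z := v) ⟨hvL, hvB⟩
      exact hvU (Or.inr ⟨X, hX, ⟨v, hvX, u, hu, huv.symm⟩, hvX⟩)
  · by_cases hvB : ∃ c ∈ C₀, G.Adj c v
    · obtain ⟨x, hx, p, hp, hxp⟩ := hXA
      have hC₀ : C₀.Nonempty := by
        obtain ⟨c, hc, -⟩ := hvB
        exact ⟨c, hc⟩
      have hpv : p ≠ v := by rintro rfl; exact hvA hp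
      have := lemS hch hX.2.1 (CN_clique hC hC₀)
        (Set.disjoint_left.2 fun y hy hyC => hL.1 (hX.1 hy).1 hyC)
        (by rintro ⟨y, hy, c, hc, hyc⟩; exact (hX.1 hy).2 ⟨c, hc, hyc.symm⟩) hpv
        ⟨x, hx, hxp⟩ ⟨u, huX, huv⟩ (hA hp).2 hvB
      exact hvA (hcl p hp v ⟨hvL, hvB⟩ this)
    · exact hvU (Or.inr ⟨X, hX, hXA, hX.2.2 u huX v ⟨hvL, hvB⟩ huv⟩)

structure Half (G : SimpleGraph V) (L R B : Set V) (a b : V) : Prop where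
  sub : B ⊆ L
  cn : CN G B
  aL : a ∈ L
  aB : a ∉ B
  bB : b ∈ B
  adj : G.Adj a b
  far : ∀ v ∈ L, v ∉ B → ∀ u, u ∉ L → ¬ G.Adj v u
  out : ∃ c, c ∉ L ∧ c ∉ R ∧ ∃ x ∈ B, G.Adj x c
  sep : ∀ u ∈ L, ∀ v ∈ R, ¬ G.Adj u v
  disj : ∀ u ∈ L, u ∉ R

theorem mk_half {G : SimpleGraph V} (hG : G.Connected) (hch : Chordal G) {C₀ L R : Set V}
    (hC : G.IsClique C₀) (hL : CMP G C₀ᶜ L) (hR : CMP G C₀ᶜ R) (hLR : L ≠ R) {x : V} (hx : x ∈ L)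
    (hxC : ∀ c ∈ C₀, ¬ G.Adj c x) : ∃ B a b, Half G L R B a b := by
  have hd := hL.disjoint hR hLR
  obtain ⟨r, hr⟩ := hR.2.1.1
  obtain ⟨p, hp, q, -, hq, hpq⟩ := (CN_univ hG).cut (Set.subset_univ L) ⟨x, hx⟩
    ⟨r, trivial, Set.disjoint_right.1 hd hr⟩
  have hqC : q ∈ C₀ := by
    by_contra h
    exact hq (hL.2.2 p hp q h hpq)
  have hB := attach_CN hch hC hL ⟨p, hp, q, hqC, hpq.symm⟩
  obtain ⟨b, hb, a, ha, haB, hba⟩ := hL.2.1.cut (A := {v | v ∈ L ∧ ∃ c ∈ C₀, G.Adj c v})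
    (fun v hv => hv.1) hB.1 ⟨x, hx, by rintro ⟨-, c, hc, h⟩; exact hxC c hc h⟩
  refine ⟨_, a, b, fun v hv => hv.1, hB, ha, haB, hb, hba.symm, ?_, ⟨q, hq, fun h => hR.1 h hqC, p,
    ⟨hp, q, hqC, hpq.symm⟩, hpq⟩, ?_, fun u hu hu' => Set.disjoint_left.1 hd hu hu'⟩
  · intro v hv hvB u hu hvu
    by_cases huC : u ∈ C₀
    · exact hvB ⟨hv, u, huC, hvu.symm⟩
    · exact hu (hL.2.2 v hv u huC hvu)
  · intro u hu v hv huv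
    exact hL.not_touch hR hLR ⟨u, hu, v, hv, huv⟩

theorem exists_halves {G : SimpleGraph V} (hG : G.Connected) (hch : Chordal G) {x y : V}
    (hxy : 4 ≤ G.dist x y) :
    ∃ L R B D a b d e, Half G L R B a b ∧ Half G R L D e d := by
  obtain ⟨R, hR, hyR⟩ := exists_CMP G {v | 3 ≤ G.dist x v} (z := y) (by simp; omega)
  have hR3 : ∀ r ∈ R, 3 ≤ G.dist x r := fun r hr => hR.1 hr
  let C₀ : Set V := {v | v ∉ R ∧ ∃ r ∈ R, G.Adj r v}
  have hle : ∀ c ∈ C₀, G.dist x c ≤ 2 := by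
    rintro c ⟨hc, r, hr, hrc⟩
    by_contra h
    exact hc (hR.2.2 r hr c (by simp; omega) hrc)
  have hge : ∀ c ∈ C₀, 2 ≤ G.dist x c := by
    rintro c ⟨hc, r, hr, hrc⟩
    have := dist_adj_le hG x (Or.inr hrc.symm)
    have := hR3 r hr
    omega
  let X : Set V := {v | v = x ∨ G.Adj x v}
  have hX1 : ∀ v ∈ X, G.dist x v ≤ 1 := by
    rintro v (rfl | h)
    · simp
    · exact (dist_eq_one_iff_adj.2 h).le
  have hX : CN G X := by
    refine ⟨⟨x, Or.inl rfl⟩, fun A hA ⟨a, ha⟩ hcl => Set.Subset.antisymm hA ?_⟩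
    have hxA : x ∈ A := by
      rcases hA ha with rfl | h
      · exact ha
      · exact hcl a ha x (Or.inl rfl) h.symm
    rintro v (rfl | h)
    · exact hxA
    · exact hcl x hxA v (Or.inr h) h
  have hmid : ∀ c ∈ C₀, ∃ m ∈ X, G.Adj m c := by
    intro c hc
    obtain ⟨p, hp⟩ := hG.exists_walk_length_eq_dist x c
    have h1 := hle c hc
    have h2 := hge c hc
    rw [← hp] at h1 h2
    clear hp
    match p, h1, h2 with
    | .cons h1 (.cons h2 .nil), _, _ => exact ⟨_, Or.inr h1, h2⟩
    | .nil, _, h => simp at h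
    | .cons h1 .nil, _, h => simp at h
    | .cons h1 (.cons h2 (.cons h3 p)), h, _ =>
      simp only [Walk.length_cons] at h
      omega
  have hC : G.IsClique C₀ := by
    intro s hs t ht hst
    refine lemS hch hX hR.2.1 ?_ ?_ hst (hmid s hs) (hmid t ht) hs.2 ht.2
    · refine Set.disjoint_left.2 fun v h1 h2 => ?_
      have := hX1 v h1
      have := hR3 v h2
      omega
    · rintro ⟨u, hu, v, hv, huv⟩
      have := hX1 u hu
      have := hR3 v hv
      have := dist_adj_le hG x (Or.inr huv)
      omega
  have hRC : CMP G C₀ᶜ R := by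
    refine ⟨fun r hr hrC => hrC.1 hr, hR.2.1, fun a ha b hb hab => ?_⟩
    by_contra h
    exact hb ⟨h, a, ha, hab⟩
  have hxC : x ∉ C₀ := fun h => by
    have := hge x h
    simp at this
  obtain ⟨L, hL, hxL⟩ := exists_CMP G C₀ᶜ hxC
  have hLR : L ≠ R := by
    rintro rfl
    have := hR3 x hxL
    simp at this
  obtain ⟨B, a, b, h1⟩ := mk_half hG hch hC hL hRC hLR hxL (fun c hc hcx => by
    have := hge c hc
    have h := dist_adj_le hG x (Or.inr hcx.symm)
    simp at h
    omega)
  obtain ⟨D, e, d, h2⟩ := mk_half hG hch hC hRC hL hLR.symm hyR (fun c hc hcy => by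
    have := hle c hc
    have h := dist_adj_le hG x (Or.inr hcy)
    omega)
  exact ⟨L, R, B, D, a, b, d, e, h1, h2⟩

theorem sw_ge {w : V → ℝ} (hw : ∀ v, 0 < w v) {X : Set V} (F : Finset V) (hF : ∀ v ∈ F, v ∈ X) :
    ∑ v ∈ F, w v ≤ setWeight w X := by
  unfold setWeight
  calc ∑ v ∈ F, w v = ∑ v ∈ F, if v ∈ X then w v else 0 :=
        Finset.sum_congr rfl fun v hv => by simp [hF v hv]
    _ ≤ _ := Finset.sum_le_sum_of_subset_of_nonneg (Finset.subset_univ _) fun v _ _ => by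
        split_ifs
        · exact (hw v).le
        · exact le_rfl

theorem sw_ge2 {w : V → ℝ} (hw : ∀ v, 0 < w v) {X : Set V} {x y : V} (hx : x ∈ X) (hy : y ∈ X)
    (hxy : x ≠ y) : w x + w y ≤ setWeight w X := by
  have := sw_ge hw (X := X) {x, y} (by simp [hx, hy])
  rwa [Finset.sum_pair hxy] at this

theorem sw_ge3 {w : V → ℝ} (hw : ∀ v, 0 < w v) {X : Set V} {x y z : V} (hx : x ∈ X) (hy : y ∈ X)
    (hz : z ∈ X) (hxy : x ≠ y) (hxz : x ≠ z) (hyz : y ≠ z) :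
    w x + w y + w z ≤ setWeight w X := by
  have := sw_ge hw (X := X) {x, y, z} (by simp [hx, hy, hz])
  rw [Finset.sum_insert (by simp [hxy, hxz]), Finset.sum_pair hyz] at this
  linarith

theorem sw_le {w : V → ℝ} (hw : ∀ v, 0 < w v) {X : Set V} (p : V) {t : ℝ} (ht : 0 ≤ t)
    (h : ∀ v ∈ X, v ≠ p → w v ≤ t) : setWeight w X ≤ w p + Fintype.card V * t := by
  unfold setWeight
  calc _ ≤ ∑ v : V, ((if v = p then w p else 0) + t) := by
        refine Finset.sum_le_sum fun v _ => ?_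
        by_cases hv : v = p
        · subst hv
          have := hw v
          simp only [if_true]
          split_ifs <;> linarith
        · simp only [hv, if_false, zero_add]
          split_ifs with hX
          · exact h v hX hv
          · exact ht
    _ = _ := by
        rw [Finset.sum_add_distrib]
        simp

theorem noconn_half {G : SimpleGraph V} (hG : G.Connected) {w : V → ℝ} (hw : ∀ v, 0 < w v)
    {L R B D : Set V} {a b d e : V} (hL : Half G L R B a b) (hR : Half G R L D e d) {ρ η : ℝ}
    (hρ : 0 < ρ) (hρ1 : ρ ≤ 1/100) (hη : η = 50 * ρ) (hN : Fintype.card V * η = 1/2)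
    (wa : w a = 1 - ρ) (wb : w b = 1) (wd : w d = 1) (we : w e = 1 - ρ)
    (wl : ∀ v, v ≠ a → v ≠ b → v ≠ d → v ≠ e → w v ≤ η) (wC : ∀ v, v ∉ L → v ∉ R → w v = η)
    {S : Set V} (hS : IsConnSafeSet G w S) (hSw : setWeight w S ≤ 2 + 2 * ρ)
    (hd : d ∉ S) (he : e ∉ S) : False := by
  have hcn : CN G S := (CN_iff _ _).2 hS.2
  obtain ⟨Z, hZ, hdZ⟩ := exists_CMP G Sᶜ hd
  have heZ : e ∈ Z := hZ.2.2 d hdZ e he hR.adj.symm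
  have hSS : CMP G S S := ⟨subset_rfl, hcn, fun _ _ _ h _ => h⟩
  have hZS : setWeight w Z ≤ setWeight w S := by
    refine hS.1.2.2 S Z ((CMP_iff _ _ _).2 hSS) ((CMP_iff _ _ _).2 hZ) ?_
    obtain ⟨s, hs⟩ := hcn.1
    obtain ⟨z, hz, q, -, hq, hzq⟩ := (CN_univ hG).cut (Set.subset_univ Z) ⟨d, hdZ⟩
      ⟨s, trivial, fun h => hZ.1 h hs⟩
    refine ⟨q, ?_, z, hz, hzq.symm⟩
    by_contra h
    exact hq (hZ.2.2 z hz q h hzq)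
  have hde : d ≠ e := hR.adj.ne'
  have hab : a ≠ b := hL.adj.ne
  have hZ2 := sw_ge2 hw hdZ heZ hde
  have hη0 : 0 ≤ η := by linarith
  have haS : a ∈ S := by
    by_contra h
    have := sw_le hw (X := S) b hη0 (fun v hv hvb => wl v (by rintro rfl; exact h hv) hvb
      (by rintro rfl; exact hd hv) (by rintro rfl; exact he hv))
    linarith
  have hbS : b ∈ S := by
    by_contra h
    have := sw_le hw (X := S) a hη0 (fun v hv hva => wl v hva (by rintro rfl; exact h hv)
      (by rintro rfl; exact hd hv) (by rintro rfl; exact he hv))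
    linarith
  have hout : ∀ c ∈ S, c ∈ L ∨ c ∈ R := by
    intro c hc
    by_contra! h
    have := sw_ge3 hw haS hbS hc hab (by rintro rfl; exact h.1 hL.aL)
      (by rintro rfl; exact h.1 (hL.sub hL.bB))
    have := wC c h.1 h.2
    linarith
  have hSL : S ⊆ L := by
    have := hcn.2 (S ∩ L) Set.inter_subset_left ⟨a, haS, hL.aL⟩ (fun u hu v hv huv =>
      ⟨hv, (hout v hv).resolve_right fun h => hL.sep u hu.2 v h huv⟩)
    rw [← this]; exact Set.inter_subset_right
  have hDZ : D ⊆ Z := hR.cn.subset_CMP hZ (fun v hv hvS => hL.disj v (hSL hvS) (hR.sub hv))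
    hR.bB hdZ
  obtain ⟨c, hcR, hcL, x, hx, hxc⟩ := hR.out
  have hcZ : c ∈ Z := hZ.2.2 x (hDZ hx) c (fun h => hcL (hSL h)) hxc
  have := sw_ge3 hw hdZ heZ hcZ hde (by rintro rfl; exact hcR (hR.sub hR.bB))
    (by rintro rfl; exact hcR hR.aL)
  have := wC c hcL hcR
  linarith

theorem noconn {G : SimpleGraph V} (hG : G.Connected) {w : V → ℝ} (hw : ∀ v, 0 < w v)
    {L R B D : Set V} {a b d e : V} (hL : Half G L R B a b) (hR : Half G R L D e d) {ρ η : ℝ}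
    (hρ : 0 < ρ) (hρ1 : ρ ≤ 1/100) (hη : η = 50 * ρ) (hN : Fintype.card V * η = 1/2)
    (wa : w a = 1 - ρ) (wb : w b = 1) (wd : w d = 1) (we : w e = 1 - ρ)
    (wl : ∀ v, v ≠ a → v ≠ b → v ≠ d → v ≠ e → w v ≤ η) (wC : ∀ v, v ∉ L → v ∉ R → w v = η)
    {S : Set V} (hS : IsConnSafeSet G w S) (hSw : setWeight w S ≤ 2 + 2 * ρ) : False := by
  have hcn : CN G S := (CN_iff _ _).2 hS.2
  by_cases h1 : d ∈ S ∨ e ∈ S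
  · by_cases h2 : a ∈ S ∨ b ∈ S
    · have hp : ∃ p ∈ S, p ∈ L ∧ 1 - ρ ≤ w p := by
        rcases h2 with h | h
        · exact ⟨a, h, hL.aL, wa.ge⟩
        · exact ⟨b, h, hL.sub hL.bB, by linarith⟩
      have hq : ∃ p ∈ S, p ∈ R ∧ 1 - ρ ≤ w p := by
        rcases h1 with h | h
        · exact ⟨d, h, hR.sub hR.bB, by linarith⟩
        · exact ⟨e, h, hR.aL, we.ge⟩
      obtain ⟨p, hp, hpL, hpw⟩ := hp
      obtain ⟨q, hq, hqR, hqw⟩ := hq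
      obtain ⟨u, hu, v, hv, hvL, huv⟩ := hcn.cut (A := S ∩ L) Set.inter_subset_left ⟨p, hp, hpL⟩
        ⟨q, hq, fun h => hL.disj q h.2 hqR⟩
      have hvL' : v ∉ L := fun h => hvL ⟨hv, h⟩
      have hvR : v ∉ R := fun h => hL.sep u hu.2 v h huv
      have := sw_ge3 hw hp hq hv (by rintro rfl; exact hL.disj p hpL hqR)
        (by rintro rfl; exact hvL' hpL) (by rintro rfl; exact hvR hqR)
      have := wC v hvL' hvR
      linarith
    · push Not at h2
      exact noconn_half hG hw hR hL hρ hρ1 hη hN we wd wb wa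
        (fun v h1 h2 h3 h4 => wl v h4 h3 h2 h1) (fun v h1 h2 => wC v h2 h1) hS hSw h2.2 h2.1
  · push Not at h1
    exact noconn_half hG hw hL hR hρ hρ1 hη hN wa wb wd we wl wC hS hSw h1.1 h1.2

theorem not_Gcs {G : SimpleGraph V} (hG : G.Connected) {L R B D : Set V} {a b d e : V}
    (hL : Half G L R B a b) (hR : Half G R L D e d) : ¬ InGcs G := by
  intro hcs
  have hN1 : (1 : ℝ) ≤ Fintype.card V := by
    have : 0 < Fintype.card V := Fintype.card_pos_iff.2 ⟨a⟩
    exact_mod_cast this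
  obtain ⟨ρ, hρdef⟩ : ∃ ρ : ℝ, ρ = 1 / (100 * Fintype.card V) := ⟨_, rfl⟩
  have hNρ : Fintype.card V * ρ = 1/100 := by
    rw [hρdef]; field_simp
  have hρ : 0 < ρ := by rw [hρdef]; positivity
  have hρ1 : ρ ≤ 1/100 := by nlinarith
  obtain ⟨ε, hεdef⟩ : ∃ ε : ℝ, ε = ρ / Fintype.card V := ⟨_, rfl⟩
  have hNε : Fintype.card V * ε = ρ := by
    rw [hεdef]; field_simp
  have hε : 0 < ε := by rw [hεdef]; positivity
  have hερ : ε ≤ ρ := by nlinarith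
  have haL := hL.aL
  have hbL := hL.sub hL.bB
  have heR := hR.aL
  have hdR := hR.sub hR.bB
  have hdL : ∀ v ∈ R, v ∉ L := fun v h h' => hL.disj v h' h
  have hab : a ≠ b := hL.adj.ne
  have hde : d ≠ e := hR.adj.ne'
  have had : a ≠ d := by rintro rfl; exact hdL _ hdR haL
  have hae : a ≠ e := by rintro rfl; exact hdL _ heR haL
  have hbd : b ≠ d := by rintro rfl; exact hdL _ hdR hbL
  have hbe : b ≠ e := by rintro rfl; exact hdL _ heR hbL
  obtain ⟨w, hwdef⟩ : ∃ w : V → ℝ, ∀ v, w v = if v = b ∨ v = d then 1 else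
    if v = a ∨ v = e then 1 - ρ else if v ∈ L ∨ v ∈ R then ε else 50 * ρ := ⟨_, fun _ => rfl⟩
  have wa : w a = 1 - ρ := by rw [hwdef]; simp [hab, had]
  have wb : w b = 1 := by rw [hwdef]; simp
  have wd : w d = 1 := by rw [hwdef]; simp
  have we : w e = 1 - ρ := by rw [hwdef]; simp [hbe.symm, hde.symm]
  have wlε : ∀ v, v ≠ a → v ≠ b → v ≠ d → v ≠ e → (v ∈ L ∨ v ∈ R) → w v = ε := by
    intro v h1 h2 h3 h4 h5
    rw [hwdef]; simp [h1, h2, h3, h4, h5]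
  have wC : ∀ v, v ∉ L → v ∉ R → w v = 50 * ρ := by
    intro v h1 h2
    have h3 : v ≠ a := by rintro rfl; exact h1 haL
    have h4 : v ≠ b := by rintro rfl; exact h1 hbL
    have h5 : v ≠ d := by rintro rfl; exact h2 hdR
    have h6 : v ≠ e := by rintro rfl; exact h2 heR
    rw [hwdef]; simp [h1, h2, h3, h4, h5, h6]
  have wl : ∀ v, v ≠ a → v ≠ b → v ≠ d → v ≠ e → w v ≤ 50 * ρ := by
    intro v h1 h2 h3 h4
    by_cases h : v ∈ L ∨ v ∈ R
    · rw [wlε v h1 h2 h3 h4 h]; linarith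
    · push Not at h
      exact (wC v h.1 h.2).le
  have hw : ∀ v, 0 < w v := by
    intro v
    rw [hwdef]
    split_ifs <;> linarith
  have hN : Fintype.card V * (50 * ρ) = 1/2 := by linarith
  -- weights of the parts
  have hdisj : Disjoint B D := Set.disjoint_left.2 fun v h1 h2 => hL.disj v (hL.sub h1) (hR.sub h2)
  have hBw : setWeight w B ≤ 1 + ρ := by
    have := sw_le hw (X := B) b hε.le (fun v hv hvb => (wlε v (by rintro rfl; exact hL.aB hv) hvb
      (by rintro rfl; exact hdL _ hdR (hL.sub hv)) (by rintro rfl; exact hdL _ heR (hL.sub hv))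
      (Or.inl (hL.sub hv))).le)
    linarith
  have hDw : setWeight w D ≤ 1 + ρ := by
    have := sw_le hw (X := D) d hε.le (fun v hv hvb => (wlε v
      (by rintro rfl; exact hdL _ (hR.sub hv) haL) (by rintro rfl; exact hdL _ (hR.sub hv) hbL)
      hvb (by rintro rfl; exact hR.aB hv) (Or.inr (hR.sub hv))).le)
    linarith
  have hBw' : 1 ≤ setWeight w B := by
    have := sw_ge hw (X := B) {b} (by simpa using hL.bB)
    simpa [wb] using this
  have hDw' : 1 ≤ setWeight w D := by
    have := sw_ge hw (X := D) {d} (by simpa using hR.bB)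
    simpa [wd] using this
  -- the safe set
  have hcB : CMP G (B ∪ D) B := ⟨Set.subset_union_left, hL.cn, by
    rintro u hu v (hv | hv) huv
    · exact hv
    · exact absurd huv (hL.sep u (hL.sub hu) v (hR.sub hv))⟩
  have hcD : CMP G (B ∪ D) D := ⟨Set.subset_union_right, hR.cn, by
    rintro u hu v (hv | hv) huv
    · exact absurd huv (hR.sep u (hR.sub hu) v (hL.sub hv))
    · exact hv⟩
  have hsafe : IsSafeSet G w (B ∪ D) := by
    refine ⟨⟨b, Or.inl hL.bB⟩, fun h => ?_, fun C Z hC hZ _ => ?_⟩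
    · have : a ∈ B ∪ D := h ▸ trivial
      rcases this with h | h
      · exact hL.aB h
      · exact hdL _ (hR.sub h) haL
    · rw [CMP_iff] at hC hZ
      have h1 : 1 ≤ setWeight w C := by
        obtain ⟨c, hc⟩ := hC.2.1.1
        rcases hC.1 hc with h | h
        · rw [hC.eq hcB hc h]; exact hBw'
        · rw [hC.eq hcD hc h]; exact hDw'
      refine le_trans ?_ h1
      have hZB : ∀ z ∈ Z, z ∉ B := fun z hz h => hZ.1 hz (Or.inl h)
      have hZD : ∀ z ∈ Z, z ∉ D := fun z hz h => hZ.1 hz (Or.inr h)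
      by_cases hA : ∃ z ∈ Z, z ∈ L
      · obtain ⟨z, hz, hzL⟩ := hA
        have hZL : Z ⊆ L := by
          have := hZ.2.1.2 (Z ∩ L) Set.inter_subset_left ⟨z, hz, hzL⟩ (fun u hu v hv huv => by
            refine ⟨hv, ?_⟩
            by_contra h
            exact hL.far u hu.2 (hZB u hu.1) v h huv)
          rw [← this]; exact Set.inter_subset_right
        have := sw_le hw (X := Z) a hε.le (fun v hv hva => (wlε v hva
          (by rintro rfl; exact hZB _ hv hL.bB) (by rintro rfl; exact hZD _ hv hR.bB)
          (by rintro rfl; exact hdL _ heR (hZL hv)) (Or.inl (hZL hv))).le)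
        linarith
      · by_cases hE : ∃ z ∈ Z, z ∈ R
        · obtain ⟨z, hz, hzR⟩ := hE
          have hZR : Z ⊆ R := by
            have := hZ.2.1.2 (Z ∩ R) Set.inter_subset_left ⟨z, hz, hzR⟩ (fun u hu v hv huv => by
              refine ⟨hv, ?_⟩
              by_contra h
              exact hR.far u hu.2 (hZD u hu.1) v h huv)
            rw [← this]; exact Set.inter_subset_right
          have := sw_le hw (X := Z) e hε.le (fun v hv hve => (wlε v
            (by rintro rfl; exact hdL _ (hZR hv) haL)
            (by rintro rfl; exact hZB _ hv hL.bB) (by rintro rfl; exact hZD _ hv hR.bB)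
            hve (Or.inr (hZR hv))).le)
          linarith
        · push Not at hA hE
          obtain ⟨z, hz⟩ := hZ.2.1.1
          have := sw_le hw (X := Z) z (t := 50 * ρ) (by linarith)
            (fun v hv _ => (wC v (hA v hv) (hE v hv)).le)
          have := wC z (hA z hz) (hE z hz)
          linarith
  have hSw : setWeight w (B ∪ D) ≤ 2 + 2 * ρ := by
    rw [sw_union hdisj]; linarith
  have heq := hcs w hw
  have hs_le : safeNumber G w ≤ 2 + 2 * ρ := by
    have hmem : setWeight w (B ∪ D) ∈ setWeight w '' {S | IsSafeSet G w S} := ⟨_, hsafe, rfl⟩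
    exact (csInf_le (Set.toFinite _).bddBelow hmem).trans hSw
  have hs_pos : 0 < safeNumber G w := by
    have hmem : safeNumber G w ∈ setWeight w '' {S | IsSafeSet G w S} :=
      Set.Nonempty.csInf_mem ⟨_, _, hsafe, rfl⟩ (Set.toFinite _)
    obtain ⟨S, hS, hSe⟩ := hmem
    rw [← hSe]
    exact sw_pos hw hS.1
  by_cases hne : ∃ S, IsConnSafeSet G w S
  · obtain ⟨S₀, hS₀⟩ := hne
    have hmem : connSafeNumber G w ∈ setWeight w '' {S | IsConnSafeSet G w S} :=
      Set.Nonempty.csInf_mem ⟨_, _, hS₀, rfl⟩ (Set.toFinite _)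
    obtain ⟨S, hS, hSe⟩ := hmem
    exact noconn hG hw hL hR hρ hρ1 rfl hN wa wb wd we wl wC hS (by rw [hSe, ← heq]; exact hs_le)
  · have h2 : {S | IsConnSafeSet G w S} = ∅ := by
      ext S; simp only [Set.mem_setOf_eq, Set.mem_empty_iff_false, iff_false]
      exact fun h => hne ⟨S, h⟩
    have : connSafeNumber G w = 0 := by
      unfold connSafeNumber
      rw [h2]; simp
    linarith

theorem stmt_14 (G : SimpleGraph V) (hG : G.Connected) (hch : Chordal G) :
    ((∃ K : Set V, G.IsClique K ∧ ∀ v ∉ K, ∃ u ∈ K, G.Adj v u) ↔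
      (∀ u v : V, G.dist u v ≤ 3)) ∧
    ((∀ u v : V, G.dist u v ≤ 3) ↔ InGcs G) := by
  have h21 := dist_clique hG hch
  refine ⟨⟨fun ⟨K, hK, hd⟩ => clique_dist hG hK hd, h21⟩, fun h => ?_, fun h => ?_⟩
  · obtain ⟨K, hK, hd⟩ := h21 h
    exact clique_Gcs hG hch hK hd
  · by_contra! hcon
    obtain ⟨x, y, hxy⟩ := hcon
    obtain ⟨L, R, B, D, a, b, d, e, h1, h2⟩ := exists_halves hG hch hxy
    exact not_Gcs hG h1 h2 h
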